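/- Let K be the field of fractions of ℚ[x,y] and let u : ℤ → K satisfy u_0 = x, u_1 = y, u_n ≠ 0 for all n, and u_{n+1}·u_{n−1} = 1 + u_n² for all n ∈ ℤ. Then for every n ≥ 2, u_n = ∑_{q=0}^{n−1} C(n−1, q) · x^{1−n} y^{2q−n+2} + ∑_{p=1}^{n−1} ∑_{q=0}^{n−1−p} C(n−2−q, p) · C(n−1−p, q) · x^{2p−n+1} y^{2q−n+2}, where C(a,b) denotes the binomial coefficient (equal to 0 when b > a). -/

import Mathlib

/-- The coefficient of `X ^ p * Y ^ q` in the numerator of the cluster variable `u (m + 2)`. -/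
def czCoeff (m p q : ℕ) : ℕ := (m - q).choose p * (m + 1 - p).choose q

lemma czCoeff_eq_zero_of_left_lt {m p q : ℕ} (h : m < p) : czCoeff m p q = 0 := by
  rw [czCoeff, Nat.choose_eq_zero_of_lt (by omega : m - q < p), zero_mul]

lemma czCoeff_eq_zero_of_right_lt {m p q : ℕ} (h : m + 1 < q) : czCoeff m p q = 0 := by
  rw [czCoeff, Nat.choose_eq_zero_of_lt (by omega : m + 1 - p < q), mul_zero]

lemma czCoeff_zero_left (m q : ℕ) : czCoeff m 0 q = (m + 1).choose q := by
  simp [czCoeff]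

lemma czCoeff_zero_right (m p : ℕ) : czCoeff m p 0 = m.choose p := by
  simp [czCoeff]

lemma czCoeff_rec (m p q : ℕ) :
    czCoeff (m + 2) (p + 1) (q + 1) + czCoeff m p q =
      czCoeff (m + 1) (p + 1) (q + 1) + czCoeff (m + 1) p (q + 1) +
        czCoeff (m + 1) (p + 1) q := by
  rcases lt_or_ge m p with hp | hp
  · have h₁ : (m + 1 - (q + 1)).choose p = 0 := Nat.choose_eq_zero_of_lt (by omega)
    have h₂ : (m + 2 - (q + 1)).choose (p + 1) = 0 := Nat.choose_eq_zero_of_lt (by omega)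
    have h₃ : czCoeff (m + 1) (p + 1) q = 0 := czCoeff_eq_zero_of_left_lt (by omega)
    have h₄ : czCoeff (m + 1) (p + 1) (q + 1) = 0 := czCoeff_eq_zero_of_left_lt (by omega)
    rw [h₃, h₄, czCoeff_eq_zero_of_left_lt hp, czCoeff, czCoeff, h₁, h₂]
    simp
  rcases lt_or_ge m q with hq | hq
  · have e₁ : m + 2 - (q + 1) = 0 := by omega
    have e₂ : m + 1 - (q + 1) = 0 := by omega
    have e₃ : m - q = 0 := by omega
    have e₄ : m + 1 - q = 0 := by omega
    rcases p with _ | p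
    · rcases (Nat.succ_le_of_lt hq).eq_or_lt with rfl | hq
      · simp [czCoeff]
      · simp [czCoeff, e₁, e₂, e₃, e₄, Nat.choose_eq_zero_of_lt (by omega : m + 1 < q),
          Nat.choose_eq_zero_of_lt (by omega : m + 1 + 1 < q + 1)]
    · simp [czCoeff, e₁, e₂, e₃, e₄]
  have e₁ : m + 2 - (q + 1) = m - q + 1 := by omega
  have e₂ : m + 1 - (q + 1) = m - q := by omega
  have e₃ : m + 1 - q = m - q + 1 := by omega
  have e₄ : m + 2 + 1 - (p + 1) = m + 1 - p + 1 := by omega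
  have e₅ : m + 1 + 1 - (p + 1) = m + 1 - p := by omega
  have e₆ : m + 1 + 1 - p = m + 1 - p + 1 := by omega
  simp only [czCoeff, e₁, e₂, e₃, e₄, e₅, e₆, Nat.choose_succ_succ']
  ring

section CommRing

variable {R : Type*} [CommRing R]

/-- The numerator of `u (m + 2)`, as a polynomial in `X = x ^ 2` and `Y = y ^ 2`. -/
def czNumerator (X Y : R) (m : ℕ) : R :=
  ∑ p ∈ Finset.range (m + 2), ∑ q ∈ Finset.range (m + 2), (czCoeff m p q : R) * (X ^ p * Y ^ q)

lemma czNumerator_eq_sum (X Y : R) {m M N : ℕ} (hM : m + 1 ≤ M) (hN : m + 2 ≤ N) :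
    czNumerator X Y m =
      ∑ p ∈ Finset.range M, ∑ q ∈ Finset.range N, (czCoeff m p q : R) * (X ^ p * Y ^ q) := by
  have key : ∀ {M N : ℕ}, m + 1 ≤ M → m + 2 ≤ N →
      ∑ p ∈ Finset.range (m + 1), ∑ q ∈ Finset.range (m + 2),
          (czCoeff m p q : R) * (X ^ p * Y ^ q) =
        ∑ p ∈ Finset.range M, ∑ q ∈ Finset.range N,
          (czCoeff m p q : R) * (X ^ p * Y ^ q) := by
    intro M N hM hN
    rw [← Finset.sum_product', ← Finset.sum_product']
    refine Finset.sum_subset (Finset.product_subset_product (Finset.range_mono hM)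
      (Finset.range_mono hN)) fun i _ hi => ?_
    rcases lt_or_ge m i.1 with h | h
    · simp [czCoeff_eq_zero_of_left_lt h]
    · have : m + 1 < i.2 := by
        simp only [Finset.mem_product, Finset.mem_range] at hi
        omega
      simp [czCoeff_eq_zero_of_right_lt this]
  rw [czNumerator, ← key (by omega) le_rfl, key hM hN]

lemma czNumerator_rec (X Y : R) (m : ℕ) :
    czNumerator X Y (m + 2) + X * Y * czNumerator X Y m =
      (1 + X + Y) * czNumerator X Y (m + 1) := by
  have hY : Y * czNumerator X Y (m + 1) = ∑ p ∈ Finset.range (m + 4 + 1),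
      ∑ q ∈ Finset.range (m + 4), (czCoeff (m + 1) p q : R) * (X ^ p * Y ^ (q + 1)) := by
    rw [czNumerator_eq_sum X Y (M := m + 4 + 1) (N := m + 4) (by omega) (by omega)]
    simp only [Finset.mul_sum]
    exact Finset.sum_congr rfl fun p _ => Finset.sum_congr rfl fun q _ => by ring
  have hX : X * czNumerator X Y (m + 1) = ∑ p ∈ Finset.range (m + 4),
      ∑ q ∈ Finset.range (m + 4 + 1), (czCoeff (m + 1) p q : R) * (X ^ (p + 1) * Y ^ q) := by
    rw [czNumerator_eq_sum X Y (M := m + 4) (N := m + 4 + 1) (by omega) (by omega)]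
    simp only [Finset.mul_sum]
    exact Finset.sum_congr rfl fun p _ => Finset.sum_congr rfl fun q _ => by ring
  have hXY : X * Y * czNumerator X Y m = ∑ p ∈ Finset.range (m + 4),
      ∑ q ∈ Finset.range (m + 4), (czCoeff m p q : R) * (X ^ (p + 1) * Y ^ (q + 1)) := by
    rw [czNumerator_eq_sum X Y (M := m + 4) (N := m + 4) (by omega) (by omega)]
    simp only [Finset.mul_sum]
    exact Finset.sum_congr rfl fun p _ => Finset.sum_congr rfl fun q _ => by ring
  have hrow : ∑ q ∈ Finset.range (m + 4), (czCoeff (m + 2) 0 (q + 1) : R) * Y ^ (q + 1) =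
      ∑ q ∈ Finset.range (m + 4), (czCoeff (m + 1) 0 (q + 1) : R) * Y ^ (q + 1) +
        ∑ q ∈ Finset.range (m + 4), (czCoeff (m + 1) 0 q : R) * Y ^ (q + 1) := by
    rw [← Finset.sum_add_distrib]
    refine Finset.sum_congr rfl fun q _ => ?_
    simp only [czCoeff_zero_left, Nat.choose_succ_succ' (m + 2) q, Nat.cast_add]
    ring
  have hcol : ∑ p ∈ Finset.range (m + 4), (czCoeff (m + 2) (p + 1) 0 : R) * X ^ (p + 1) =
      ∑ p ∈ Finset.range (m + 4), (czCoeff (m + 1) (p + 1) 0 : R) * X ^ (p + 1) +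
        ∑ p ∈ Finset.range (m + 4), (czCoeff (m + 1) p 0 : R) * X ^ (p + 1) := by
    rw [← Finset.sum_add_distrib]
    refine Finset.sum_congr rfl fun p _ => ?_
    simp only [czCoeff_zero_right, Nat.choose_succ_succ' (m + 1) p, Nat.cast_add]
    ring
  have hmain : ∑ p ∈ Finset.range (m + 4), ∑ q ∈ Finset.range (m + 4),
        (czCoeff (m + 2) (p + 1) (q + 1) : R) * (X ^ (p + 1) * Y ^ (q + 1)) +
      ∑ p ∈ Finset.range (m + 4), ∑ q ∈ Finset.range (m + 4),
        (czCoeff m p q : R) * (X ^ (p + 1) * Y ^ (q + 1)) =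
      ∑ p ∈ Finset.range (m + 4), ∑ q ∈ Finset.range (m + 4),
        (czCoeff (m + 1) (p + 1) (q + 1) : R) * (X ^ (p + 1) * Y ^ (q + 1)) +
      ∑ p ∈ Finset.range (m + 4), ∑ q ∈ Finset.range (m + 4),
        (czCoeff (m + 1) p (q + 1) : R) * (X ^ (p + 1) * Y ^ (q + 1)) +
      ∑ p ∈ Finset.range (m + 4), ∑ q ∈ Finset.range (m + 4),
        (czCoeff (m + 1) (p + 1) q : R) * (X ^ (p + 1) * Y ^ (q + 1)) := by
    simp only [← Finset.sum_add_distrib, ← add_mul]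
    exact_mod_cast Finset.sum_congr rfl fun p _ => Finset.sum_congr rfl fun q _ => by
      rw [czCoeff_rec]
  rw [add_mul, add_mul, one_mul, hX, hY, hXY,
    czNumerator_eq_sum X Y (m := m + 2) (M := m + 4 + 1) (N := m + 4 + 1) (by omega) (by omega),
    czNumerator_eq_sum X Y (m := m + 1) (M := m + 4 + 1) (N := m + 4 + 1) (by omega) (by omega)]
  simp only [Finset.sum_range_succ' _ (m + 4), Finset.sum_add_distrib, pow_zero, mul_one, one_mul]
  simp only [czCoeff_zero_left (q := 0), Nat.choose_zero_right]
  linear_combination hmain + hrow + hcol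

end CommRing

section Field

variable {K : Type*} [Field K]

lemma exchange_linear_rec {u : ℤ → K} (hne : ∀ n, u n ≠ 0)
    (hrec : ∀ n, u (n + 1) * u (n - 1) = 1 + u n ^ 2) (n : ℕ) :
    (u (n + 2) + u n) * (u 0 * u 1) = (1 + u 0 ^ 2 + u 1 ^ 2) * u (n + 1) := by
  have step : ∀ k : ℤ, u (k + 2) * u k = 1 + u (k + 1) ^ 2 := fun k => by
    have := hrec (k + 1)
    rwa [add_sub_cancel_right, add_assoc, one_add_one_eq_two] at this
  induction n with
  | zero =>
    have := step 0
    simp only [zero_add] at this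
    simp only [Nat.cast_zero, zero_add]
    linear_combination u 1 * this
  | succ n ih =>
    have h₁ := step n
    have h₂ := step (n + 1)
    rw [show (n : ℤ) + 1 + 1 = n + 2 by ring] at h₂
    push_cast
    rw [show (n : ℤ) + 1 + 1 = n + 2 by ring]
    refine mul_right_cancel₀ (hne (n + 1)) ?_
    linear_combination u 0 * u 1 * (h₂ - h₁) + u (n + 2) * ih

lemma exchange_mul_eq_czNumerator {u : ℤ → K} (hne : ∀ n, u n ≠ 0)
    (hrec : ∀ n, u (n + 1) * u (n - 1) = 1 + u n ^ 2) (m : ℕ) :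
    u (m + 2) * (u 0 ^ (m + 1) * u 1 ^ m) = czNumerator (u 0 ^ 2) (u 1 ^ 2) m := by
  have r1 := exchange_linear_rec hne hrec 1
  have e := hrec 1
  norm_num at r1 e
  induction m using Nat.twoStepInduction with
  | zero =>
    simp [czNumerator, Finset.sum_range_succ, czCoeff]
    linear_combination e
  | one =>
    simp [czNumerator, Finset.sum_range_succ, czCoeff, Nat.choose]
    linear_combination u 0 * r1 + (1 + u 0 ^ 2 + u 1 ^ 2) * e
  | more m ih₁ ih₂ =>
    have r := exchange_linear_rec hne hrec (m + 2)
    have s := czNumerator_rec (u 0 ^ 2) (u 1 ^ 2) m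
    rw [← ih₁, ← ih₂] at s
    push_cast at r s ⊢
    rw [show (m : ℤ) + 2 + 1 = m + 1 + 2 by ring] at r
    linear_combination u 0 ^ (m + 2) * u 1 ^ (m + 1) * r - s

lemma czNumerator_mul_zpow {x y : K} (hx : x ≠ 0) (hy : y ≠ 0) (m : ℕ) :
    czNumerator (x ^ 2) (y ^ 2) m * (x ^ (-(m : ℤ) - 1) * y ^ (-(m : ℤ))) =
      ∑ q ∈ Finset.range (m + 2), ((m + 1).choose q : K) *
          x ^ (-(m : ℤ) - 1) * y ^ (2 * (q : ℤ) - m) +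
        ∑ p ∈ Finset.Icc 1 (m + 1), ∑ q ∈ Finset.range (m + 2 - p),
          ((m - q).choose p : K) * ((m + 1 - p).choose q : K) *
            x ^ (2 * (p : ℤ) - m - 1) * y ^ (2 * (q : ℤ) - m) := by
  have hterm : ∀ p q : ℕ,
      (czCoeff m p q : K) * ((x ^ 2) ^ p * (y ^ 2) ^ q) *
          (x ^ (-(m : ℤ) - 1) * y ^ (-(m : ℤ))) =
        ((m - q).choose p : K) * ((m + 1 - p).choose q : K) *
          x ^ (2 * (p : ℤ) - m - 1) * y ^ (2 * (q : ℤ) - m) := by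
    intro p q
    rw [show 2 * (p : ℤ) - m - 1 = ((2 * p : ℕ) : ℤ) + (-(m : ℤ) - 1) by push_cast; ring,
      show 2 * (q : ℤ) - m = ((2 * q : ℕ) : ℤ) + -(m : ℤ) by push_cast; ring,
      zpow_add₀ hx, zpow_add₀ hy, zpow_natCast, zpow_natCast, pow_mul, pow_mul, czCoeff,
      Nat.cast_mul]
    ring
  simp only [czNumerator, Finset.sum_mul, hterm]
  rw [Finset.range_eq_Ico, Finset.sum_eq_sum_Ico_succ_bot (by omega)]
  congr 1
  · simp
  · refine Finset.sum_congr (by ext; simp; omega) fun p hp => ?_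
    rw [← Finset.range_eq_Ico]
    refine (Finset.sum_subset (Finset.range_mono (by omega)) fun q _ hq => ?_).symm
    rw [Finset.mem_range] at hq
    simp [Nat.choose_eq_zero_of_lt (by simp at hp; omega : m + 1 - p < q)]

end Field


/-- The Caldero–Zelevinsky formula: for `r = 2` and `n ≥ 2`,
`u n = ∑_q C(n-1,q) x^(1-n) y^(2q-n+2)
      + ∑_{p≥1} ∑_q C(n-2-q,p) C(n-1-p,q) x^(2p-n+1) y^(2q-n+2)`. -/
theorem stmt9
    (u : ℤ → FractionRing (MvPolynomial (Fin 2) ℚ))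
    (x y : FractionRing (MvPolynomial (Fin 2) ℚ))
    (hx : x = algebraMap (MvPolynomial (Fin 2) ℚ)
      (FractionRing (MvPolynomial (Fin 2) ℚ)) (MvPolynomial.X 0))
    (hy : y = algebraMap (MvPolynomial (Fin 2) ℚ)
      (FractionRing (MvPolynomial (Fin 2) ℚ)) (MvPolynomial.X 1))
    (h0 : u 0 = x) (h1 : u 1 = y)
    (hne : ∀ n : ℤ, u n ≠ 0)
    (hrec : ∀ n : ℤ, u (n + 1) * u (n - 1) = 1 + (u n) ^ 2) :
    ∀ n : ℕ, 2 ≤ n →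
      u n =
        (∑ q ∈ Finset.range n, ((n - 1).choose q : FractionRing (MvPolynomial (Fin 2) ℚ)) *
          x ^ (1 - (n : ℤ)) * y ^ (2 * (q : ℤ) - (n : ℤ) + 2)) +
        ∑ p ∈ Finset.Icc 1 (n - 1), ∑ q ∈ Finset.range (n - p),
          (((n - 2 - q).choose p : ℕ) : FractionRing (MvPolynomial (Fin 2) ℚ)) *
            (((n - 1 - p).choose q : ℕ) : FractionRing (MvPolynomial (Fin 2) ℚ)) *
            x ^ (2 * (p : ℤ) - (n : ℤ) + 1) * y ^ (2 * (q : ℤ) - (n : ℤ) + 2) := by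
  intro n hn
  obtain ⟨m, rfl⟩ := Nat.exists_eq_add_of_le' hn
  have hx0 : x ≠ 0 := h0 ▸ hne 0
  have hy0 : y ≠ 0 := h1 ▸ hne 1
  have key := exchange_mul_eq_czNumerator hne hrec m
  have hsum := czNumerator_mul_zpow hx0 hy0 m
  rw [h0, h1] at key
  rw [← key] at hsum
  have hcancel : x ^ (m + 1) * y ^ m * (x ^ (-(m : ℤ) - 1) * y ^ (-(m : ℤ))) = 1 := by
    rw [show -(m : ℤ) - 1 = -((m + 1 : ℕ) : ℤ) by push_cast; ring, zpow_neg, zpow_neg,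
      zpow_natCast, zpow_natCast]
    field_simp
  rw [mul_assoc, hcancel, mul_one] at hsum
  push_cast
  rw [hsum]
  congr 1
  · refine Finset.sum_congr rfl fun q _ => ?_
    rw [show 1 - ((m : ℤ) + 2) = -(m : ℤ) - 1 by ring,
      show 2 * (q : ℤ) - ((m : ℤ) + 2) + 2 = 2 * q - m by ring]
  · refine Finset.sum_congr rfl fun p _ => Finset.sum_congr rfl fun q _ => ?_
    rw [show 2 * (p : ℤ) - ((m : ℤ) + 2) + 1 = 2 * p - m - 1 by ring,
      show 2 * (q : ℤ) - ((m : ℤ) + 2) + 2 = 2 * q - m by ring]
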